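/- Let f : ℝ² → ℝ be a smooth function and write f_ε = ∂f/∂x^ε, f_{εη} = ∂²f/∂x^ε∂x^η for ε, η ∈ {1,2}, and W² = 1 + f_1² + f_2². Assume f_1(x)² + f_2(x)² ≥ 2 (equivalently W² ≥ 3) at every point x ∈ ℝ², and that f satisfies at every point the partial differential equation Σ_{ε,η=1,2} [ (W² − 1)(W² − 3)(δ_{εη} − f_ε f_η / W²) + 2(W² + 3) f_ε f_η / W² ] f_{εη} = 0. Then f is affine, i.e., there exist constants a₁, a₂, c ∈ ℝ with f(x¹, x²) = a₁x¹ + a₂x² + c, so the graph of f is a plane. -/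

import Mathlib

/-- Partial derivative of `f : ℝ² → ℝ` in the direction of the `ε`-th coordinate. -/
noncomputable def pd (ε : Fin 2) (f : EuclideanSpace ℝ (Fin 2) → ℝ) :
    EuclideanSpace ℝ (Fin 2) → ℝ :=
  fun x => fderiv ℝ f x (EuclideanSpace.single ε 1)

open MeasureTheory Filter Topology
open scoped ContDiff

/-- The Euclidean plane. -/
abbrev Plane := EuclideanSpace ℝ (Fin 2)

section Calculus

variable {u v : Plane → ℝ} {x : Plane} {i j : Fin 2}

lemma pd_add (hu : DifferentiableAt ℝ u x) (hv : DifferentiableAt ℝ v x) :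
    pd i (fun y => u y + v y) x = pd i u x + pd i v x := by
  simp only [pd]
  rw [fderiv_fun_add hu hv]; rfl

lemma pd_mul (hu : DifferentiableAt ℝ u x) (hv : DifferentiableAt ℝ v x) :
    pd i (fun y => u y * v y) x = u x * pd i v x + pd i u x * v x := by
  simp only [pd]
  rw [fderiv_fun_mul hu hv]
  simp [mul_comm]

lemma pd_sq (hu : DifferentiableAt ℝ u x) :
    pd i (fun y => u y ^ 2) x = 2 * u x * pd i u x := by
  simp only [sq]
  rw [pd_mul hu hu]
  ring

lemma pd_comp {g : ℝ → ℝ} {g' : ℝ} (hu : DifferentiableAt ℝ u x) (hg : HasDerivAt g g' (u x)) :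
    pd i (fun y => g (u y)) x = g' * pd i u x := by
  have h := (hg.comp_hasFDerivAt x hu.hasFDerivAt).fderiv
  simp only [pd]
  change (fderiv ℝ (g ∘ u) x) _ = _
  rw [h]
  simp

lemma pd_coord : pd i (fun y : Plane => y j) x = if i = j then 1 else 0 := by
  have h : HasFDerivAt (fun y : Plane => y j) (EuclideanSpace.proj j : Plane →L[ℝ] ℝ) x :=
    (EuclideanSpace.proj j : Plane →L[ℝ] ℝ).hasFDerivAt
  simp only [pd]
  rw [h.fderiv]
  simp [eq_comm]

lemma contDiff_pd (hu : ContDiff ℝ ∞ u) : ContDiff ℝ ∞ (pd i u) :=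
  (hu.fderiv_right (m := ∞) (by simp)).clm_apply contDiff_const

lemma pd_comm (hu : ContDiff ℝ ∞ u) : pd i (pd j u) x = pd j (pd i u) x := by
  have hsymm : IsSymmSndFDerivAt ℝ u x :=
    hu.contDiffAt.isSymmSndFDerivAt (by simpa using ENat.LEInfty.out)
  have hd : DifferentiableAt ℝ (fderiv ℝ u) x :=
    ((hu.fderiv_right (m := ∞) (by simp)).differentiable (by simp)) x
  have key : ∀ v w : Plane, fderiv ℝ (fun y => fderiv ℝ u y v) x w
      = fderiv ℝ (fderiv ℝ u) x w v := by
    intro v w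
    rw [fderiv_clm_apply hd (differentiableAt_const v)]
    simp
  change fderiv ℝ (fun y => fderiv ℝ u y _) x _ = fderiv ℝ (fun y => fderiv ℝ u y _) x _
  rw [key, key]
  exact hsymm _ _

lemma hasCompactSupport_pd (hu : HasCompactSupport u) : HasCompactSupport (pd i u) :=
  (hu.fderiv (𝕜 := ℝ)).comp_left (g := fun L : Plane →L[ℝ] ℝ => L (EuclideanSpace.single i 1))
    (by simp)

lemma integral_pd_eq_zero (hu : ContDiff ℝ ∞ u) (hc : HasCompactSupport u) :
    ∫ x, pd i u x = 0 := by
  have hi : Integrable (pd i u) :=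
    (contDiff_pd hu).continuous.integrable_of_hasCompactSupport (hasCompactSupport_pd hc)
  have := integral_mul_fderiv_eq_neg_fderiv_mul_of_integrable (μ := (volume : Measure Plane))
    (f := fun _ => (1 : ℝ)) (g := u) (v := EuclideanSpace.single i 1)
    (by simp) (by simpa using! hi)
    (by simpa using hu.continuous.integrable_of_hasCompactSupport hc)
    (fun _ _ => differentiableAt_const _)
    (fun x _ => hu.differentiable (by simp) x)
  simpa using! this

/-- A smooth divergence-free vector field is weakly divergence free. -/
lemma integral_flux_eq_zero {X Y ψ : Plane → ℝ} (hX : ContDiff ℝ ∞ X) (hY : ContDiff ℝ ∞ Y)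
    (hψ : ContDiff ℝ ∞ ψ) (hc : HasCompactSupport ψ) (hdiv : ∀ x, pd 0 X x + pd 1 Y x = 0) :
    ∫ x, (X x * pd 0 ψ x + Y x * pd 1 ψ x) = 0 := by
  have hXd := hX.differentiable (by simp)
  have hYd := hY.differentiable (by simp)
  have hψd := hψ.differentiable (by simp)
  have h0 : ContDiff ℝ ∞ (fun x => X x * ψ x) := hX.mul hψ
  have h1 : ContDiff ℝ ∞ (fun x => Y x * ψ x) := hY.mul hψ
  have c0 : HasCompactSupport (fun x => X x * ψ x) := hc.mul_left
  have c1 : HasCompactSupport (fun x => Y x * ψ x) := hc.mul_left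
  have e : ∀ x, X x * pd 0 ψ x + Y x * pd 1 ψ x
      = pd 0 (fun x => X x * ψ x) x + pd 1 (fun x => Y x * ψ x) x := by
    intro x
    rw [pd_mul (hXd x) (hψd x), pd_mul (hYd x) (hψd x)]
    linear_combination (-ψ x) * hdiv x
  simp_rw [e]
  rw [integral_add, integral_pd_eq_zero h0 c0, integral_pd_eq_zero h1 c1, add_zero]
  · exact (contDiff_pd h0).continuous.integrable_of_hasCompactSupport (hasCompactSupport_pd c0)
  · exact (contDiff_pd h1).continuous.integrable_of_hasCompactSupport (hasCompactSupport_pd c1)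

end Calculus

section Cutoff

/-- A smooth cutoff on the line, equal to `1` on `(-∞, 1]` and to `0` on `[2, ∞)`. -/
noncomputable def cutoff (t : ℝ) : ℝ := Real.smoothTransition (2 - t)

lemma contDiff_cutoff : ContDiff ℝ ∞ cutoff :=
  Real.smoothTransition.contDiff.comp (contDiff_const.sub contDiff_id)

lemma cutoff_nonneg (t : ℝ) : 0 ≤ cutoff t := Real.smoothTransition.nonneg _

lemma cutoff_le_one (t : ℝ) : cutoff t ≤ 1 := Real.smoothTransition.le_one _

lemma cutoff_eq_one {t : ℝ} (ht : t ≤ 1) : cutoff t = 1 :=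
  Real.smoothTransition.one_of_one_le (by linarith)

lemma cutoff_eq_zero {t : ℝ} (ht : 2 ≤ t) : cutoff t = 0 :=
  Real.smoothTransition.zero_of_nonpos (by linarith)

lemma hasDerivAt_cutoff (t : ℝ) : HasDerivAt cutoff (deriv cutoff t) t :=
  (contDiff_cutoff.differentiable (by simp) t).hasDerivAt

lemma deriv_cutoff_of_le {t : ℝ} (ht : t ≤ 1) : deriv cutoff t = 0 := by
  apply IsLocalMax.deriv_eq_zero
  exact Eventually.of_forall fun s => by
    change cutoff s ≤ cutoff t
    rw [cutoff_eq_one ht]; exact cutoff_le_one s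

lemma deriv_cutoff_of_ge {t : ℝ} (ht : 2 ≤ t) : deriv cutoff t = 0 := by
  apply IsLocalMin.deriv_eq_zero
  exact Eventually.of_forall fun s => by
    change cutoff t ≤ cutoff s
    rw [cutoff_eq_zero ht]; exact cutoff_nonneg s

lemma exists_deriv_cutoff_bound : ∃ K : ℝ, 0 ≤ K ∧ ∀ t, |deriv cutoff t| ≤ K := by
  have hc : Continuous (deriv cutoff) := contDiff_cutoff.continuous_deriv (by simp)
  obtain ⟨K, hK⟩ := (isCompact_Icc (a := (1 : ℝ)) (b := 2)).exists_bound_of_continuousOn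
    hc.continuousOn
  refine ⟨max K 0, le_max_right _ _, fun t => ?_⟩
  by_cases h1 : t ≤ 1
  · simp [deriv_cutoff_of_le h1]
  by_cases h2 : 2 ≤ t
  · simp [deriv_cutoff_of_ge h2]
  · exact (hK t ⟨by linarith, by linarith⟩).trans (le_max_left _ _)

end Cutoff

section Algebra

/-- The scalar factor of the conservation law equivalent to the Kropina minimal-graph equation,
as a function of `q = |∇f|²`. -/
noncomputable def conductivity (q : ℝ) : ℝ := (q - 2) * √(1 + q) / q ^ 2

/-- The derivative of `conductivity`. -/
noncomputable def conductivityDeriv (q : ℝ) : ℝ := (8 + 4 * q - q ^ 2) / (2 * q ^ 3 * √(1 + q))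

lemma hasDerivAt_conductivity {q : ℝ} (hq : 0 < q) :
    HasDerivAt conductivity (conductivityDeriv q) q := by
  have hs : HasDerivAt (fun t : ℝ => √(1 + t)) (1 / (2 * √(1 + q))) q :=
    ((hasDerivAt_id q).const_add 1).sqrt (by simp; positivity)
  have h := (((hasDerivAt_id q).sub_const 2).mul hs).div (hasDerivAt_pow 2 q) (by positivity)
  refine h.congr_deriv ?_
  have hw : 0 < √(1 + q) := Real.sqrt_pos.2 (by linarith)
  have hw2 : √(1 + q) ^ 2 = 1 + q := Real.sq_sqrt (by linarith)
  simp only [conductivityDeriv, id, Pi.mul_apply]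
  generalize √(1 + q) = w at *
  field_simp
  push_cast
  ring_nf
  have : q = w ^ 2 - 1 := by linarith
  subst this
  ring

/-- The linearized conductivity, a quadratic form depending on the gradient `(p, r)`. -/
noncomputable def linForm (p r a b c d : ℝ) : ℝ :=
  conductivity (p ^ 2 + r ^ 2) * (a * c + b * d) +
    2 * conductivityDeriv (p ^ 2 + r ^ 2) * (p * a + r * b) * (p * c + r * d)

variable {p r : ℝ}

lemma conductivity_nonneg {q : ℝ} (hq : 2 ≤ q) : 0 ≤ conductivity q := by
  have : 0 ≤ q - 2 := by linarith
  unfold conductivity; positivity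

lemma conductivity_add {q : ℝ} (hq : 2 ≤ q) :
    conductivity q + 2 * conductivityDeriv q * q = 3 * (q + 2) / (q ^ 2 * √(1 + q)) := by
  have hw : 0 < √(1 + q) := Real.sqrt_pos.2 (by linarith)
  have hw2 : √(1 + q) ^ 2 = 1 + q := Real.sq_sqrt (by linarith)
  have hq0 : 0 < q := by linarith
  simp only [conductivity, conductivityDeriv]
  generalize √(1 + q) = w at *
  field_simp
  rw [hw2]; ring

lemma le_linForm (h : 2 ≤ p ^ 2 + r ^ 2) (a b : ℝ) :
    3 * ((p ^ 2 + r ^ 2) + 2) / ((p ^ 2 + r ^ 2) ^ 3 * √(1 + (p ^ 2 + r ^ 2))) *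
      (p * a + r * b) ^ 2 ≤ linForm p r a b a b := by
  have h1 := conductivity_add h
  have h2 := conductivity_nonneg h
  have hcs : (p * a + r * b) ^ 2 ≤ (p ^ 2 + r ^ 2) * (a ^ 2 + b ^ 2) := by
    nlinarith [sq_nonneg (p * b - r * a)]
  unfold linForm
  set q := p ^ 2 + r ^ 2
  have hq0 : 0 < q := by linarith
  have h3 : 3 * (q + 2) / (q ^ 3 * √(1 + q)) =
      (conductivity q + 2 * conductivityDeriv q * q) / q := by
    rw [h1]; field_simp
  rw [h3]
  have h4 : (conductivity q + 2 * conductivityDeriv q * q) / q * (p * a + r * b) ^ 2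
      = conductivity q * ((p * a + r * b) ^ 2 / q) +
        2 * conductivityDeriv q * (p * a + r * b) ^ 2 := by
    field_simp
  have h5 : (p * a + r * b) ^ 2 / q ≤ a ^ 2 + b ^ 2 := by
    rw [div_le_iff₀ hq0]; linarith
  have h6 := mul_le_mul_of_nonneg_left h5 h2
  rw [h4]
  nlinarith

lemma linForm_nonneg (h : 2 ≤ p ^ 2 + r ^ 2) (a b : ℝ) : 0 ≤ linForm p r a b a b :=
  le_trans (by positivity) (le_linForm h a b)

lemma eq_zero_of_linForm_eq_zero (h : 2 ≤ p ^ 2 + r ^ 2) {a b : ℝ}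
    (h0 : linForm p r a b a b = 0) : p * a + r * b = 0 := by
  have h1 := le_linForm h a b
  rw [h0] at h1
  have hpos : 0 < 3 * ((p ^ 2 + r ^ 2) + 2) /
      ((p ^ 2 + r ^ 2) ^ 3 * √(1 + (p ^ 2 + r ^ 2))) := by
    have : 0 < p ^ 2 + r ^ 2 := by linarith
    positivity
  by_contra hne
  have := mul_pos hpos (sq_pos_of_ne_zero hne)
  linarith

lemma linForm_young (h : 2 ≤ p ^ 2 + r ^ 2) (a b c d : ℝ) {t m : ℝ} (ht : 0 < t) (hm : 0 < m)
    (s k : ℝ) :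
    -(2 * s * k * linForm p r a b c d) ≤
      t * (s ^ 2 * (linForm p r a b a b / m)) + t⁻¹ * (k ^ 2 * (m * linForm p r c d c d)) := by
  have h1 := linForm_nonneg h (t * s * a + k * m * c) (t * s * b + k * m * d)
  have h2 : linForm p r (t * s * a + k * m * c) (t * s * b + k * m * d)
      (t * s * a + k * m * c) (t * s * b + k * m * d)
      = t ^ 2 * s ^ 2 * linForm p r a b a b + 2 * t * s * k * m * linForm p r a b c d
        + k ^ 2 * m ^ 2 * linForm p r c d c d := by
    unfold linForm; ring
  rw [h2] at h1
  have h3 : t * (s ^ 2 * (linForm p r a b a b / m)) + t⁻¹ * (k ^ 2 * (m * linForm p r c d c d))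
      + (2 * s * k * linForm p r a b c d) = (t ^ 2 * s ^ 2 * linForm p r a b a b +
        2 * t * s * k * m * linForm p r a b c d + k ^ 2 * m ^ 2 * linForm p r c d c d) / (t * m) := by
    field_simp
    ring
  have h4 := div_nonneg h1 (mul_pos ht hm).le
  linarith

lemma linForm_le (h : 2 ≤ p ^ 2 + r ^ 2) (a b c : ℝ) :
    (1 + (p ^ 2 + r ^ 2)) * linForm p r (a + c * p) (b + c * r) (a + c * p) (b + c * r) ≤
      12 * √(1 + (p ^ 2 + r ^ 2)) * (a ^ 2 + b ^ 2 + c ^ 2) := by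
  have h1 := conductivity_add h
  have hnn := linForm_nonneg h (a - c * p) (b - c * r)
  have hpar : linForm p r (a + c * p) (b + c * r) (a + c * p) (b + c * r) =
      2 * linForm p r a b a b + 2 * (c ^ 2 * linForm p r p r p r) -
        linForm p r (a - c * p) (b - c * r) (a - c * p) (b - c * r) := by
    unfold linForm; ring
  have hcs : (p * a + r * b) ^ 2 ≤ (p ^ 2 + r ^ 2) * (a ^ 2 + b ^ 2) := by
    nlinarith [sq_nonneg (p * b - r * a)]
  have hgg : linForm p r p r p r = (p ^ 2 + r ^ 2) * (conductivity (p ^ 2 + r ^ 2) +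
      2 * conductivityDeriv (p ^ 2 + r ^ 2) * (p ^ 2 + r ^ 2)) := by
    unfold linForm; ring
  have haa : linForm p r a b a b = conductivity (p ^ 2 + r ^ 2) * (a ^ 2 + b ^ 2) +
      2 * conductivityDeriv (p ^ 2 + r ^ 2) * (p * a + r * b) ^ 2 := by
    unfold linForm; ring
  rw [h1] at hgg
  set q := p ^ 2 + r ^ 2
  have hq0 : 0 < q := by linarith
  have hw : 0 < √(1 + q) := Real.sqrt_pos.2 (by linarith)
  have hw2 : √(1 + q) ^ 2 = 1 + q := Real.sq_sqrt (by linarith)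
  have e1 : linForm p r p r p r ≤ 6 / √(1 + q) := by
    rw [hgg, ← mul_div_assoc, div_le_div_iff₀ (by positivity) hw]
    have : q * (3 * (q + 2)) ≤ 6 * q ^ 2 := by nlinarith
    nlinarith
  have e2 : conductivity q ≤ 2 / √(1 + q) := by
    unfold conductivity
    rw [div_le_div_iff₀ (by positivity) hw]
    nlinarith
  have e3 : 2 * conductivityDeriv q * (p * a + r * b) ^ 2 ≤ 4 / √(1 + q) * (a ^ 2 + b ^ 2) := by
    have f1 : 2 * conductivityDeriv q ≤ 8 / (q ^ 2 * √(1 + q)) := by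
      unfold conductivityDeriv
      rw [← mul_div_assoc, div_le_div_iff₀ (by positivity) (by positivity)]
      have : 0 ≤ q ^ 2 * √(1 + q) * (q ^ 2 + 4 * q - 8) := by
        have : 0 ≤ q ^ 2 + 4 * q - 8 := by nlinarith
        positivity
      nlinarith
    calc 2 * conductivityDeriv q * (p * a + r * b) ^ 2
        ≤ 8 / (q ^ 2 * √(1 + q)) * (p * a + r * b) ^ 2 := by gcongr
      _ ≤ 8 / (q ^ 2 * √(1 + q)) * (q * (a ^ 2 + b ^ 2)) := by gcongr
      _ = (8 / q) / √(1 + q) * (a ^ 2 + b ^ 2) := by field_simp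
      _ ≤ 4 / √(1 + q) * (a ^ 2 + b ^ 2) := by
        gcongr
        rw [div_le_iff₀ hq0]; linarith
  have e4 : linForm p r a b a b ≤ 6 / √(1 + q) * (a ^ 2 + b ^ 2) := by
    have := mul_le_mul_of_nonneg_right e2 (by positivity : 0 ≤ a ^ 2 + b ^ 2)
    have e : 6 / √(1 + q) = 2 / √(1 + q) + 4 / √(1 + q) := by ring
    rw [haa, e, add_mul]; linarith
  have e5 : linForm p r (a + c * p) (b + c * r) (a + c * p) (b + c * r) ≤
      12 / √(1 + q) * (a ^ 2 + b ^ 2 + c ^ 2) := by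
    have := mul_le_mul_of_nonneg_left e1 (sq_nonneg c)
    have e : 12 / √(1 + q) = 2 * (6 / √(1 + q)) := by ring
    rw [hpar, e]; nlinarith
  calc _ ≤ (1 + q) * (12 / √(1 + q) * (a ^ 2 + b ^ 2 + c ^ 2)) := by gcongr
    _ = _ := by
      field_simp; rw [hw2]

/-- The flux of the conservation law has length at most one. -/
lemma flux_le_one (h : 2 ≤ p ^ 2 + r ^ 2) :
    (conductivity (p ^ 2 + r ^ 2) * p) ^ 2 + (conductivity (p ^ 2 + r ^ 2) * r) ^ 2 ≤ 1 := by
  have e : (conductivity (p ^ 2 + r ^ 2) * p) ^ 2 + (conductivity (p ^ 2 + r ^ 2) * r) ^ 2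
    = conductivity (p ^ 2 + r ^ 2) ^ 2 * (p ^ 2 + r ^ 2) := by ring
  rw [e]
  set q := p ^ 2 + r ^ 2
  have hw2 : √(1 + q) ^ 2 = 1 + q := Real.sq_sqrt (by linarith)
  unfold conductivity
  rw [div_pow, mul_pow, hw2, div_mul_eq_mul_div, div_le_one (by positivity)]
  nlinarith [mul_nonneg (by linarith : (0 : ℝ) ≤ q - 2) (by linarith : (0 : ℝ) ≤ q)]

lemma sqrt_le_two_add {q : ℝ} (hq : 2 ≤ q) : √(1 + q) ≤ 2 + conductivity q * q := by
  have hw : 0 < √(1 + q) := Real.sqrt_pos.2 (by linarith)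
  have hw2 : √(1 + q) ^ 2 = 1 + q := Real.sq_sqrt (by linarith)
  have hq0 : 0 < q := by linarith
  have e : 2 + conductivity q * q = √(1 + q) + 2 * (q - √(1 + q)) / q := by
    unfold conductivity; field_simp; ring
  have h1 : 0 ≤ q - √(1 + q) := by
    by_contra! hlt
    nlinarith
  have : 0 ≤ 2 * (q - √(1 + q)) / q := by positivity
  linarith

end Algebra

section Rigidity

lemma fderiv_apply_eq_pd (u : Plane → ℝ) (x v : Plane) :
    fderiv ℝ u x v = v 0 * pd 0 u x + v 1 * pd 1 u x := by
  have hv : v = v 0 • EuclideanSpace.single (0 : Fin 2) (1 : ℝ) +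
      v 1 • EuclideanSpace.single (1 : Fin 2) (1 : ℝ) := by
    ext i; fin_cases i <;> simp
  conv_lhs => rw [hv]
  simp [pd]

lemma hasDerivAt_comp_smul {u : Plane → ℝ} (hu : Differentiable ℝ u) (v : Plane) (t : ℝ) :
    HasDerivAt (fun s : ℝ => u (s • v)) (v 0 * pd 0 u (t • v) + v 1 * pd 1 u (t • v)) t := by
  rw [← fderiv_apply_eq_pd]
  have h : HasDerivAt (fun s : ℝ => s • v) v t := by
    simpa using (hasDerivAt_id t).smul_const v
  exact (hu (t • v)).hasFDerivAt.comp_hasDerivAt t h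

lemma norm_sq_plane (x : Plane) : ‖x‖ ^ 2 = x 0 ^ 2 + x 1 ^ 2 := by
  simp [EuclideanSpace.real_norm_sq_eq]

variable {f : Plane → ℝ}

/-- If the gradient is in the kernel of the Hessian, it is constant on the line it spans. -/
lemma pd_eq_of_hessian_grad_eq_zero (hf : ContDiff ℝ ∞ f)
    (hH : ∀ i x, pd 0 f x * pd 0 (pd i f) x + pd 1 f x * pd 1 (pd i f) x = 0) (σ : ℝ)
    (i : Fin 2) : pd i f (σ • !₂[pd 0 f 0, pd 1 f 0]) = pd i f 0 := by
  set v : Plane := σ • !₂[pd 0 f 0, pd 1 f 0] with hv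
  have hv0 : v 0 = σ * pd 0 f 0 := by simp [hv]
  have hv1 : v 1 = σ * pd 1 f 0 := by simp [hv]
  have hd : ∀ i, Differentiable ℝ (pd i f) := fun i => (contDiff_pd hf).differentiable (by simp)
  have hcont : ∀ i j, Continuous (fun t : ℝ => pd j (pd i f) (t • v)) := fun i j =>
    (contDiff_pd (contDiff_pd hf)).continuous.comp (by fun_prop)
  have hbd : ∀ i j, ∃ C, ∀ t ∈ Set.Icc (0 : ℝ) 1, ‖pd j (pd i f) (t • v)‖ ≤ C := fun i j =>
    isCompact_Icc.exists_bound_of_continuousOn (hcont i j).continuousOn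
  choose C hC using hbd
  set F : ℝ → ℝ × ℝ := fun t => (pd 0 f (t • v) - pd 0 f 0, pd 1 f (t • v) - pd 1 f 0) with hF
  have hder : ∀ i t, HasDerivAt (fun t : ℝ => pd i f (t • v) - pd i f 0)
      (-σ * ((F t).1 * pd 0 (pd i f) (t • v) + (F t).2 * pd 1 (pd i f) (t • v))) t := by
    intro i t
    refine ((hasDerivAt_comp_smul (hd i) v t).sub_const _).congr_deriv ?_
    rw [hv0, hv1]
    simp only [hF]
    linear_combination σ * hH i (t • v)
  have hFd : ∀ t, HasDerivAt F _ t := fun t => (hder 0 t).prodMk (hder 1 t)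
  set M : ℝ := |σ| * (|C 0 0| + |C 0 1| + |C 1 0| + |C 1 1|) with hM
  have hbound : ∀ i, ∀ t ∈ Set.Icc (0 : ℝ) 1,
      ‖-σ * ((F t).1 * pd 0 (pd i f) (t • v) + (F t).2 * pd 1 (pd i f) (t • v))‖
        ≤ |σ| * (|C i 0| + |C i 1|) * ‖F t‖ := by
    intro i t ht
    rw [norm_mul, norm_neg, Real.norm_eq_abs, mul_assoc]
    gcongr
    refine (norm_add_le _ _).trans ?_
    rw [norm_mul, norm_mul, add_mul, mul_comm ‖(F t).1‖, mul_comm ‖(F t).2‖]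
    gcongr
    · exact (hC i 0 t ht).trans (le_abs_self _)
    · exact norm_fst_le _
    · exact (hC i 1 t ht).trans (le_abs_self _)
    · exact norm_snd_le _
  have hF1 := eq_zero_of_abs_deriv_le_mul_abs_self_of_eq_zero_right (f := F) (K := M)
    (a := 0) (b := 1) (fun t _ => (hFd t).continuousAt.continuousWithinAt)
    (fun t _ => (hFd t).hasDerivWithinAt) (by simp [hF]) (by
      intro t ht
      have ht' : t ∈ Set.Icc (0 : ℝ) 1 := Set.Ico_subset_Icc_self ht
      rw [Prod.norm_mk]
      refine max_le ((hbound 0 t ht').trans ?_) ((hbound 1 t ht').trans ?_) <;>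
      · rw [hM]
        refine mul_le_mul_of_nonneg_right (mul_le_mul_of_nonneg_left ?_ (abs_nonneg σ))
          (norm_nonneg _)
        have := abs_nonneg (C 0 0)
        have := abs_nonneg (C 0 1)
        have := abs_nonneg (C 1 0)
        have := abs_nonneg (C 1 1)
        linarith) 1 (by simp)
  have h0 := congrArg Prod.fst hF1
  have h1 := congrArg Prod.snd hF1
  simp only [hF, one_smul, Prod.fst_zero, Prod.snd_zero] at h0 h1
  fin_cases i
  · exact sub_eq_zero.1 h0
  · exact sub_eq_zero.1 h1

/-- An entire function without critical points whose gradient lies in the kernel of its Hessian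
is affine. -/
lemma affine_of_hessian_grad_eq_zero (hf : ContDiff ℝ ∞ f)
    (hH : ∀ i x, pd 0 f x * pd 0 (pd i f) x + pd 1 f x * pd 1 (pd i f) x = 0)
    (hpos : 0 < pd 0 f 0 ^ 2 + pd 1 f 0 ^ 2) (y : Plane) :
    f y = pd 0 f 0 * y 0 + pd 1 f 0 * y 1 + f 0 := by
  have hfd : Differentiable ℝ f := hf.differentiable (by simp)
  have hd : ∀ i, Differentiable ℝ (pd i f) := fun i => (contDiff_pd hf).differentiable (by simp)
  set a := pd 0 f 0 with ha
  set b := pd 1 f 0 with hb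
  set c := a ^ 2 + b ^ 2 with hc
  have hconst : ∀ x, pd 0 f x ^ 2 + pd 1 f x ^ 2 = c := by
    have hqd : Differentiable ℝ (fun x => pd 0 f x ^ 2 + pd 1 f x ^ 2) :=
      ((hd 0).pow 2).add ((hd 1).pow 2)
    have hz : ∀ i x, pd i (fun x => pd 0 f x ^ 2 + pd 1 f x ^ 2) x = 0 := by
      intro i x
      rw [pd_add (u := fun x => pd 0 f x ^ 2) (v := fun x => pd 1 f x ^ 2)
        ((hd 0 x).pow 2) ((hd 1 x).pow 2), pd_sq (hd 0 x), pd_sq (hd 1 x),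
        pd_comm (j := 0) hf, pd_comm (j := 1) hf]
      linear_combination 2 * hH i x
    intro x
    refine is_const_of_fderiv_eq_zero hqd (fun x => ?_) x 0
    ext v
    rw [fderiv_apply_eq_pd, hz, hz]
    simp
  have hlip : ∀ x z : Plane, |f x - f z| ≤ √c * ‖x - z‖ := by
    intro x z
    refine Convex.norm_image_sub_le_of_norm_fderiv_le (𝕜 := ℝ) (s := Set.univ)
      (fun x _ => hfd x) (fun x _ => ?_) convex_univ (Set.mem_univ _) (Set.mem_univ _)
    refine ContinuousLinearMap.opNorm_le_bound _ (Real.sqrt_nonneg _) (fun v => ?_)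
    rw [fderiv_apply_eq_pd, Real.norm_eq_abs]
    apply abs_le_of_sq_le_sq _ (by positivity)
    rw [mul_pow, Real.sq_sqrt hpos.le, norm_sq_plane, ← hconst x]
    nlinarith [sq_nonneg (v 0 * pd 1 f x - v 1 * pd 0 f x)]
  have hline : ∀ T : ℝ, f (T • !₂[a, b]) = f 0 + T * c := by
    intro T
    have hdz : ∀ t, HasDerivAt (fun s : ℝ => f (s • !₂[a, b]) - s * c) 0 t := by
      intro t
      refine ((hasDerivAt_comp_smul hfd !₂[a, b] t).sub
        ((hasDerivAt_id t).mul_const c)).congr_deriv ?_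
      rw [pd_eq_of_hessian_grad_eq_zero hf hH, pd_eq_of_hessian_grad_eq_zero hf hH]
      simp [← ha, ← hb, hc]
      ring
    have := is_const_of_deriv_eq_zero (fun t => (hdz t).differentiableAt)
      (fun t => (hdz t).deriv) T 0
    simp only [zero_smul, zero_mul, sub_zero] at this
    linarith
  set L := a * y 0 + b * y 1 with hL
  have hdist : ∀ T τ : ℝ, 0 < τ → T ^ 2 = τ ^ 2 →
      √c * ‖y - T • !₂[a, b]‖ ≤ τ * c - T / τ * L + ‖y‖ ^ 2 / (2 * τ) := by
    intro T τ hτ hT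
    have hA : (√c * ‖y - T • !₂[a, b]‖) ^ 2 = c * (‖y‖ ^ 2 - 2 * T * L + τ ^ 2 * c) := by
      rw [mul_pow, Real.sq_sqrt hpos.le, norm_sq_plane, norm_sq_plane, ← hT]
      have e0 : (y - T • !₂[a, b]) 0 = y 0 - T * a := by simp
      have e1 : (y - T • !₂[a, b]) 1 = y 1 - T * b := by simp
      rw [e0, e1, hL, hc]
      ring
    have e : τ * c - T / τ * L + ‖y‖ ^ 2 / (2 * τ) =
        ((√c * ‖y - T • !₂[a, b]‖) ^ 2 + (τ * c) ^ 2) / (2 * (τ * c)) := by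
      rw [hA]; field_simp; ring
    rw [e, le_div_iff₀ (by positivity)]
    nlinarith [sq_nonneg (√c * ‖y - T • !₂[a, b]‖ - τ * c)]
  have key : ∀ τ : ℝ, 0 < τ → |f y - (L + f 0)| ≤ ‖y‖ ^ 2 / (2 * τ) := by
    intro τ hτ
    have h1 := hlip y (τ • !₂[a, b])
    have h2 := hlip y ((-τ) • !₂[a, b])
    have h3 := hdist τ τ hτ rfl
    have h4 := hdist (-τ) τ hτ (by ring)
    rw [hline] at h1 h2
    rw [abs_le] at h1 h2 ⊢
    rw [div_self hτ.ne'] at h3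
    rw [neg_div, div_self hτ.ne'] at h4
    constructor <;> linarith
  have hlim : Tendsto (fun τ : ℝ => ‖y‖ ^ 2 / (2 * τ)) atTop (𝓝 0) :=
    tendsto_const_nhds.div_atTop (tendsto_id.const_mul_atTop two_pos)
  have h0 : |f y - (L + f 0)| ≤ 0 := ge_of_tendsto hlim
    ((eventually_gt_atTop 0).mono fun τ hτ => key τ hτ)
  exact sub_eq_zero.1 (abs_nonpos_iff.1 h0)

end Rigidity

section BallCutoff

/-- A cutoff adapted to the ball of radius `√s` in space, restricted to the graph of `f`. -/
noncomputable def graphCutoff (f : Plane → ℝ) (s : ℝ) (x : Plane) : ℝ :=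
  cutoff ((x 0 ^ 2 + x 1 ^ 2 + f x ^ 2) / s)

variable {f : Plane → ℝ} {s : ℝ}

lemma graphCutoff_nonneg (x : Plane) : 0 ≤ graphCutoff f s x := cutoff_nonneg _

lemma graphCutoff_le_one (x : Plane) : graphCutoff f s x ≤ 1 := cutoff_le_one _

lemma graphCutoff_eq_one (hs : 0 < s) {x : Plane} (hx : x 0 ^ 2 + x 1 ^ 2 + f x ^ 2 ≤ s) :
    graphCutoff f s x = 1 :=
  cutoff_eq_one ((div_le_one hs).2 hx)

lemma graphCutoff_eq_zero (hs : 0 < s) {x : Plane} (hx : 2 * s ≤ x 0 ^ 2 + x 1 ^ 2 + f x ^ 2) :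
    graphCutoff f s x = 0 :=
  cutoff_eq_zero ((le_div_iff₀ hs).2 hx)

lemma contDiff_coord (i : Fin 2) : ContDiff ℝ ∞ (fun y : Plane => y i) :=
  (EuclideanSpace.proj i : Plane →L[ℝ] ℝ).contDiff

lemma contDiff_graphCutoff (hf : ContDiff ℝ ∞ f) : ContDiff ℝ ∞ (graphCutoff f s) :=
  contDiff_cutoff.comp
    (((((contDiff_coord 0).pow 2).add ((contDiff_coord 1).pow 2)).add (hf.pow 2)).div_const s)

lemma hasCompactSupport_graphCutoff (hs : 0 < s) : HasCompactSupport (graphCutoff f s) := by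
  refine HasCompactSupport.of_support_subset_isCompact
    (isCompact_closedBall (0 : Plane) (√(2 * s))) (fun x hx => ?_)
  rw [mem_closedBall_zero_iff]
  apply Real.le_sqrt_of_sq_le
  rw [norm_sq_plane]
  by_contra! h
  exact hx (graphCutoff_eq_zero hs (by nlinarith [sq_nonneg (f x)]))

lemma pd_graphCutoff (hf : ContDiff ℝ ∞ f) (i : Fin 2) (x : Plane) :
    pd i (graphCutoff f s) x = deriv cutoff ((x 0 ^ 2 + x 1 ^ 2 + f x ^ 2) / s) *
      (2 / s * (x i + f x * pd i f x)) := by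
  have hfd : DifferentiableAt ℝ f x := hf.differentiable (by simp) x
  have hc : ∀ j, DifferentiableAt ℝ (fun y : Plane => y j) x := fun j =>
    (contDiff_coord j).differentiable (by simp) x
  have h01 : DifferentiableAt ℝ (fun y : Plane => y 0 ^ 2 + y 1 ^ 2) x :=
    ((hc 0).fun_pow 2).fun_add ((hc 1).fun_pow 2)
  have h2 : DifferentiableAt ℝ (fun y : Plane => y 0 ^ 2 + y 1 ^ 2 + f y ^ 2) x :=
    h01.fun_add (hfd.fun_pow 2)
  have e : pd i (fun y : Plane => y 0 ^ 2 + y 1 ^ 2 + f y ^ 2) x =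
      2 * (x i + f x * pd i f x) := by
    rw [pd_add h01 (hfd.fun_pow 2), pd_add ((hc 0).fun_pow 2) ((hc 1).fun_pow 2), pd_sq (hc 0),
      pd_sq (hc 1), pd_sq hfd, pd_coord, pd_coord]
    fin_cases i <;> simp <;> ring
  have hg : HasDerivAt (fun t => cutoff (t / s))
      (deriv cutoff ((x 0 ^ 2 + x 1 ^ 2 + f x ^ 2) / s) * (1 / s))
      (x 0 ^ 2 + x 1 ^ 2 + f x ^ 2) :=
    (hasDerivAt_cutoff _).comp _ ((hasDerivAt_id _).div_const s)
  change pd i (fun y => cutoff ((y 0 ^ 2 + y 1 ^ 2 + f y ^ 2) / s)) x = _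
  rw [pd_comp h2 hg, e]
  ring

/-- The integral of the flat cutoff scales like the area of a disc. -/
lemma integral_flatCutoff (hs : 0 < s) :
    ∫ x, graphCutoff (fun _ => 0) s x = s * ∫ x, graphCutoff (fun _ => 0) 1 x := by
  have h := Measure.integral_comp_smul (volume : Measure Plane) (graphCutoff (fun _ => 0) s) (√s)
  have hs2 : √s ^ 2 = s := Real.sq_sqrt hs.le
  have e : ∀ x, graphCutoff (fun _ => 0) s (√s • x) = graphCutoff (fun _ => 0) 1 x := by
    intro x
    simp only [graphCutoff, PiLp.smul_apply, smul_eq_mul, mul_pow, hs2]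
    congr 1
    field_simp
    ring
  simp_rw [e] at h
  rw [h]
  simp only [finrank_euclideanSpace, Fintype.card_fin, hs2, smul_eq_mul]
  rw [abs_of_pos (inv_pos.2 hs)]
  field_simp

end BallCutoff

section ConservationLaw

/-- The `i`-th component of the flux of the conservation law. -/
noncomputable def kropinaFlux (f : Plane → ℝ) (i : Fin 2) (x : Plane) : ℝ :=
  conductivity (pd 0 f x ^ 2 + pd 1 f x ^ 2) * pd i f x

variable {f : Plane → ℝ}

lemma contDiff_gradSq (hf : ContDiff ℝ ∞ f) :
    ContDiff ℝ ∞ (fun x => pd 0 f x ^ 2 + pd 1 f x ^ 2) :=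
  ((contDiff_pd hf).pow 2).add ((contDiff_pd hf).pow 2)

lemma contDiff_conductivity_comp {q : Plane → ℝ} (hq : ContDiff ℝ ∞ q) (h : ∀ x, 2 ≤ q x) :
    ContDiff ℝ ∞ (fun x => conductivity (q x)) := by
  unfold conductivity
  refine ((hq.sub contDiff_const).mul ((contDiff_const.add hq).sqrt fun x => ?_)).div (hq.pow 2)
    fun x => ?_
  · have := h x; exact ne_of_gt (by linarith)
  · have := h x; exact pow_ne_zero 2 (by linarith)

lemma continuous_conductivityDeriv_comp {q : Plane → ℝ} (hq : Continuous q) (h : ∀ x, 2 ≤ q x) :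
    Continuous (fun x => conductivityDeriv (q x)) := by
  unfold conductivityDeriv
  refine Continuous.div (by fun_prop) (by fun_prop) fun x => ?_
  have h2 := h x
  have : 0 < q x := by linarith
  positivity

lemma contDiff_kropinaFlux (hf : ContDiff ℝ ∞ f) (hgrad : ∀ x, 2 ≤ pd 0 f x ^ 2 + pd 1 f x ^ 2)
    (i : Fin 2) : ContDiff ℝ ∞ (kropinaFlux f i) :=
  (contDiff_conductivity_comp (contDiff_gradSq hf) hgrad).mul (contDiff_pd hf)

lemma pd_kropinaFlux (hf : ContDiff ℝ ∞ f) (hgrad : ∀ x, 2 ≤ pd 0 f x ^ 2 + pd 1 f x ^ 2)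
    (i j : Fin 2) (x : Plane) :
    pd i (kropinaFlux f j) x =
      conductivity (pd 0 f x ^ 2 + pd 1 f x ^ 2) * pd i (pd j f) x +
        2 * conductivityDeriv (pd 0 f x ^ 2 + pd 1 f x ^ 2) *
          (pd 0 f x * pd i (pd 0 f) x + pd 1 f x * pd i (pd 1 f) x) * pd j f x := by
  have hd : ∀ i, DifferentiableAt ℝ (pd i f) x := fun i =>
    (contDiff_pd hf).differentiable (by simp) x
  have hq : DifferentiableAt ℝ (fun x => pd 0 f x ^ 2 + pd 1 f x ^ 2) x :=
    (contDiff_gradSq hf).differentiable (by simp) x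
  have hc : DifferentiableAt ℝ (fun x => conductivity (pd 0 f x ^ 2 + pd 1 f x ^ 2)) x :=
    (contDiff_conductivity_comp (contDiff_gradSq hf) hgrad).differentiable (by simp) x
  change pd i (fun x => conductivity (pd 0 f x ^ 2 + pd 1 f x ^ 2) * pd j f x) x = _
  rw [pd_mul hc (hd j), pd_comp hq (hasDerivAt_conductivity (by linarith [hgrad x])),
    pd_add ((hd 0).fun_pow 2) ((hd 1).fun_pow 2), pd_sq (hd 0), pd_sq (hd 1)]
  ring

lemma div_pd_kropinaFlux (hf : ContDiff ℝ ∞ f) (hgrad : ∀ x, 2 ≤ pd 0 f x ^ 2 + pd 1 f x ^ 2)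
    (hdiv : ∀ x, pd 0 (kropinaFlux f 0) x + pd 1 (kropinaFlux f 1) x = 0) (i : Fin 2)
    (x : Plane) : pd 0 (pd i (kropinaFlux f 0)) x + pd 1 (pd i (kropinaFlux f 1)) x = 0 := by
  have h0 := contDiff_kropinaFlux hf hgrad 0
  have h1 := contDiff_kropinaFlux hf hgrad 1
  rw [pd_comm h0, pd_comm h1, ← pd_add ((contDiff_pd h0).differentiable (by simp) x)
    ((contDiff_pd h1).differentiable (by simp) x)]
  simp_rw [hdiv]
  simp [pd]

end ConservationLaw

section AreaGrowth

variable {f : Plane → ℝ}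

/-- A localized density which dominates the area density of the graph of `f` inside the ball
of radius `√2 * R`. -/
noncomputable def areaDensity (f : Plane → ℝ) (R : ℝ) (x : Plane) : ℝ :=
  graphCutoff (fun _ => 0) (2 * R ^ 2) x *
    (2 + 3 * (1 / (1 + (f x / R) ^ 2) * (conductivity (pd 0 f x ^ 2 + pd 1 f x ^ 2) *
      (pd 0 f x ^ 2 + pd 1 f x ^ 2))))

lemma areaDensity_nonneg (hgrad : ∀ x, 2 ≤ pd 0 f x ^ 2 + pd 1 f x ^ 2) (R : ℝ) (x : Plane) :
    0 ≤ areaDensity f R x := by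
  have := conductivity_nonneg (hgrad x)
  have := graphCutoff_nonneg (f := fun _ => 0) (s := 2 * R ^ 2) x
  unfold areaDensity
  positivity

lemma continuous_areaDensity (hf : ContDiff ℝ ∞ f)
    (hgrad : ∀ x, 2 ≤ pd 0 f x ^ 2 + pd 1 f x ^ 2) (R : ℝ) : Continuous (areaDensity f R) := by
  have h1 := hf.continuous
  have h2 := (contDiff_conductivity_comp (contDiff_gradSq hf) hgrad).continuous
  have h3 := (contDiff_gradSq hf).continuous
  have h4 : Continuous (graphCutoff (fun _ => 0) (2 * R ^ 2)) :=
    (contDiff_graphCutoff contDiff_const).continuous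
  unfold areaDensity
  refine h4.mul (continuous_const.add (continuous_const.mul (Continuous.mul ?_ (h2.mul h3))))
  exact Continuous.div (by fun_prop) (by fun_prop) fun x => by positivity

lemma hasCompactSupport_areaDensity {R : ℝ} (hR : 0 < R) :
    HasCompactSupport (areaDensity f R) :=
  (hasCompactSupport_graphCutoff (by positivity)).mul_right

lemma sqrt_le_areaDensity (hgrad : ∀ x, 2 ≤ pd 0 f x ^ 2 + pd 1 f x ^ 2) {R : ℝ} (hR : 0 < R)
    {x : Plane} (hx : x 0 ^ 2 + x 1 ^ 2 + f x ^ 2 ≤ 2 * R ^ 2) :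
    √(1 + (pd 0 f x ^ 2 + pd 1 f x ^ 2)) ≤ areaDensity f R x := by
  have hone : graphCutoff (fun _ => 0) (2 * R ^ 2) x = 1 :=
    graphCutoff_eq_one (by positivity) (by nlinarith [sq_nonneg (f x)])
  have h1 := sqrt_le_two_add (hgrad x)
  have h2 : 0 ≤ conductivity (pd 0 f x ^ 2 + pd 1 f x ^ 2) * (pd 0 f x ^ 2 + pd 1 f x ^ 2) :=
    mul_nonneg (conductivity_nonneg (hgrad x)) (by positivity)
  have h3 : 1 / 3 ≤ 1 / (1 + (f x / R) ^ 2) := by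
    apply one_div_le_one_div_of_le (by positivity)
    have : (f x / R) ^ 2 ≤ 2 := by
      rw [div_pow, div_le_iff₀ (by positivity)]
      nlinarith [sq_nonneg (x 0), sq_nonneg (x 1)]
    linarith
  unfold areaDensity
  rw [hone]
  nlinarith [mul_le_mul_of_nonneg_right h3 h2]

lemma abs_arctan_le_two (t : ℝ) : |Real.arctan t| ≤ 2 := by
  have := Real.pi_le_four
  rw [abs_le]
  constructor <;> linarith [Real.neg_pi_div_two_lt_arctan t, Real.arctan_lt_pi_div_two t]

/-- Quadratic area growth of solutions. -/
lemma exists_integral_areaDensity_le (hf : ContDiff ℝ ∞ f)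
    (hgrad : ∀ x, 2 ≤ pd 0 f x ^ 2 + pd 1 f x ^ 2)
    (hdiv : ∀ x, pd 0 (kropinaFlux f 0) x + pd 1 (kropinaFlux f 1) x = 0) :
    ∃ C : ℝ, 0 ≤ C ∧ ∀ R : ℝ, 0 < R → ∫ x, areaDensity f R x ≤ C * R ^ 2 := by
  obtain ⟨K, hK0, hK⟩ := exists_deriv_cutoff_bound
  set c := ∫ x, graphCutoff (fun _ => 0) 1 x with hc
  have hc0 : 0 ≤ c := integral_nonneg fun x => graphCutoff_nonneg x
  refine ⟨4 * c + 3 * (4 * K * (4 * c)), by positivity, fun R hR => ?_⟩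
  have hfd : Differentiable ℝ f := hf.differentiable (by simp)
  set ζ : Plane → ℝ := graphCutoff (fun _ => 0) (2 * R ^ 2) with hζ
  have hζs : ContDiff ℝ ∞ ζ := contDiff_graphCutoff contDiff_const
  have hζc : HasCompactSupport ζ := hasCompactSupport_graphCutoff (by positivity)
  set ζ' : Plane → ℝ := graphCutoff (fun _ => 0) (4 * R ^ 2) with hζ'
  have hζs' : ContDiff ℝ ∞ ζ' := contDiff_graphCutoff contDiff_const
  have hζc' : HasCompactSupport ζ' := hasCompactSupport_graphCutoff (by positivity)
  set χ : Plane → ℝ := fun x => R * Real.arctan (f x / R) with hχ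
  have hχs : ContDiff ℝ ∞ χ := contDiff_const.mul (hf.div_const R).arctan
  have hχpd : ∀ i x, pd i χ x = 1 / (1 + (f x / R) ^ 2) * pd i f x := by
    intro i x
    have hg : HasDerivAt (fun t : ℝ => R * Real.arctan (t / R)) (1 / (1 + (f x / R) ^ 2))
        (f x) := by
      refine ((((hasDerivAt_id (f x)).div_const R).arctan).const_mul R).congr_deriv ?_
      simp only [id]
      field_simp
    exact pd_comp (hfd x) hg
  set D : Plane → ℝ := fun x => ζ x * (1 / (1 + (f x / R) ^ 2) *
    (conductivity (pd 0 f x ^ 2 + pd 1 f x ^ 2) * (pd 0 f x ^ 2 + pd 1 f x ^ 2))) with hD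
  have hweak := integral_flux_eq_zero (contDiff_kropinaFlux hf hgrad 0)
    (contDiff_kropinaFlux hf hgrad 1) (hχs.mul hζs) hζc.mul_left hdiv
  set V : Plane → ℝ := fun x =>
    χ x * (kropinaFlux f 0 x * pd 0 ζ x + kropinaFlux f 1 x * pd 1 ζ x) with hV
  have hexp : ∀ x, kropinaFlux f 0 x * pd 0 (fun x => χ x * ζ x) x +
      kropinaFlux f 1 x * pd 1 (fun x => χ x * ζ x) x = D x + V x := by
    intro x
    have h1 := hχs.differentiable (by simp) x
    have h2 := hζs.differentiable (by simp) x
    rw [pd_mul h1 h2, pd_mul h1 h2, hχpd, hχpd]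
    simp only [hD, hV, kropinaFlux]
    ring
  simp_rw [hexp] at hweak
  have hDs : ContDiff ℝ ∞ D := by
    refine hζs.mul ((contDiff_const.div (contDiff_const.add ((hf.div_const R).pow 2))
      fun x => ?_).mul ((contDiff_conductivity_comp (contDiff_gradSq hf) hgrad).mul
      (contDiff_gradSq hf)))
    positivity
  have hVs : ContDiff ℝ ∞ V := hχs.mul
    (((contDiff_kropinaFlux hf hgrad 0).mul (contDiff_pd hζs)).add
      ((contDiff_kropinaFlux hf hgrad 1).mul (contDiff_pd hζs)))
  have hVbound : ∀ x, -V x ≤ 4 * K * ζ' x := by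
    intro x
    have hpd : ∀ i, pd i ζ x = deriv cutoff ((x 0 ^ 2 + x 1 ^ 2 + 0 ^ 2) / (2 * R ^ 2)) *
        (1 / R ^ 2 * x i) := by
      intro i
      rw [hζ, pd_graphCutoff contDiff_const]
      ring
    have hVx : V x = (R * deriv cutoff ((x 0 ^ 2 + x 1 ^ 2 + 0 ^ 2) / (2 * R ^ 2)) *
        Real.arctan (f x / R)) * (kropinaFlux f 0 x * x 0 + kropinaFlux f 1 x * x 1) *
          (1 / R ^ 2) := by
      simp only [hV, hpd, hχ]
      ring
    have hfl : kropinaFlux f 0 x ^ 2 + kropinaFlux f 1 x ^ 2 ≤ 1 := flux_le_one (hgrad x)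
    have hz0 : 0 ≤ ζ' x := graphCutoff_nonneg x
    by_cases hx : 2 ≤ (x 0 ^ 2 + x 1 ^ 2 + 0 ^ 2) / (2 * R ^ 2)
    · rw [hVx, deriv_cutoff_of_ge hx]
      simp only [mul_zero, zero_mul, neg_zero]
      positivity
    · rw [not_le, div_lt_iff₀ (by positivity)] at hx
      have hone : ζ' x = 1 := graphCutoff_eq_one (by positivity) (by linarith)
      have h1 : |kropinaFlux f 0 x * x 0 + kropinaFlux f 1 x * x 1| ≤ 2 * R := by
        apply abs_le_of_sq_le_sq _ (by positivity)
        have e1 : (kropinaFlux f 0 x * x 0 + kropinaFlux f 1 x * x 1) ^ 2 ≤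
            (kropinaFlux f 0 x ^ 2 + kropinaFlux f 1 x ^ 2) * (x 0 ^ 2 + x 1 ^ 2) := by
          nlinarith [sq_nonneg (kropinaFlux f 0 x * x 1 - kropinaFlux f 1 x * x 0)]
        nlinarith [mul_le_mul_of_nonneg_right hfl
          (by positivity : (0 : ℝ) ≤ x 0 ^ 2 + x 1 ^ 2)]
      refine (neg_le_abs _).trans ?_
      rw [hVx, hone, abs_mul, abs_mul, abs_mul, abs_mul, abs_of_pos hR,
        abs_of_pos (by positivity : 0 < 1 / R ^ 2)]
      calc R * |deriv cutoff ((x 0 ^ 2 + x 1 ^ 2 + 0 ^ 2) / (2 * R ^ 2))| *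
            |Real.arctan (f x / R)| * |kropinaFlux f 0 x * x 0 + kropinaFlux f 1 x * x 1| *
            (1 / R ^ 2) ≤ R * K * 2 * (2 * R) * (1 / R ^ 2) := by
            gcongr
            · exact hK _
            · exact abs_arctan_le_two _
        _ = 4 * K * 1 := by field_simp; ring
  have hDi : Integrable D := hDs.continuous.integrable_of_hasCompactSupport hζc.mul_right
  have hVc : HasCompactSupport V := by
    have h0 := hasCompactSupport_pd (i := 0) hζc
    have h1 := hasCompactSupport_pd (i := 1) hζc
    exact (h0.mul_left.add h1.mul_left).mul_left
  have hVi : Integrable V := hVs.continuous.integrable_of_hasCompactSupport hVc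
  have hζi : Integrable ζ := hζs.continuous.integrable_of_hasCompactSupport hζc
  have hζi' : Integrable ζ' := hζs'.continuous.integrable_of_hasCompactSupport hζc'
  rw [integral_add hDi hVi] at hweak
  have hDle : ∫ x, D x ≤ 4 * K * (4 * R ^ 2 * c) := by
    have h1 : ∫ x, -V x ≤ ∫ x, 4 * K * ζ' x :=
      integral_mono hVi.neg (hζi'.const_mul _) hVbound
    rw [integral_neg, integral_const_mul, hζ', integral_flatCutoff (by positivity)] at h1
    linarith
  have hsplit : ∀ x, areaDensity f R x = 2 * ζ x + 3 * D x := by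
    intro x
    simp only [areaDensity, hD, hζ]
    ring
  simp_rw [hsplit]
  rw [integral_add (hζi.const_mul 2) (hDi.const_mul 3), integral_const_mul, integral_const_mul,
    hζ, integral_flatCutoff (by positivity)]
  linarith

end AreaGrowth

section Stability

variable {f : Plane → ℝ}

/-- The energy density of the bounded function `arctan (∂ᵢ f)`. -/
noncomputable def energyDensity (f : Plane → ℝ) (i : Fin 2) (x : Plane) : ℝ :=
  linForm (pd 0 f x) (pd 1 f x) (pd 0 (pd i f) x) (pd 1 (pd i f) x)
    (pd 0 (pd i f) x) (pd 1 (pd i f) x) / (1 + pd i f x ^ 2)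

lemma energyDensity_nonneg (hgrad : ∀ x, 2 ≤ pd 0 f x ^ 2 + pd 1 f x ^ 2) (i : Fin 2)
    (x : Plane) : 0 ≤ energyDensity f i x :=
  div_nonneg (linForm_nonneg (hgrad x) _ _) (by positivity)

lemma continuous_linForm_comp (hf : ContDiff ℝ ∞ f)
    (hgrad : ∀ x, 2 ≤ pd 0 f x ^ 2 + pd 1 f x ^ 2) {a b c d : Plane → ℝ} (ha : Continuous a)
    (hb : Continuous b) (hc : Continuous c) (hd : Continuous d) :
    Continuous fun x => linForm (pd 0 f x) (pd 1 f x) (a x) (b x) (c x) (d x) := by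
  have h0 := (contDiff_pd (i := 0) hf).continuous
  have h1 := (contDiff_pd (i := 1) hf).continuous
  have h2 := (contDiff_conductivity_comp (contDiff_gradSq hf) hgrad).continuous
  have h3 := continuous_conductivityDeriv_comp (contDiff_gradSq hf).continuous hgrad
  unfold linForm
  fun_prop

lemma continuous_energyDensity (hf : ContDiff ℝ ∞ f)
    (hgrad : ∀ x, 2 ≤ pd 0 f x ^ 2 + pd 1 f x ^ 2) (i : Fin 2) :
    Continuous (energyDensity f i) := by
  have h := fun j => (contDiff_pd (i := j) (contDiff_pd (i := i) hf)).continuous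
  have h1 := (contDiff_pd (i := i) hf).continuous
  exact (continuous_linForm_comp hf hgrad (h 0) (h 1) (h 0) (h 1)).div (by fun_prop)
    fun x => by positivity

/-- The weak form of the differentiated equation, tested with `φ² arctan (∂ᵢ f)`. -/
lemma integral_energyDensity_add_eq_zero (hf : ContDiff ℝ ∞ f)
    (hgrad : ∀ x, 2 ≤ pd 0 f x ^ 2 + pd 1 f x ^ 2)
    (hdiv : ∀ x, pd 0 (kropinaFlux f 0) x + pd 1 (kropinaFlux f 1) x = 0) (i : Fin 2)
    {φ : Plane → ℝ} (hφ : ContDiff ℝ ∞ φ) (hc : HasCompactSupport φ) :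
    ∫ x, (φ x ^ 2 * energyDensity f i x + 2 * φ x * Real.arctan (pd i f x) *
      linForm (pd 0 f x) (pd 1 f x) (pd 0 (pd i f) x) (pd 1 (pd i f) x)
        (pd 0 φ x) (pd 1 φ x)) = 0 := by
  have hP : ContDiff ℝ ∞ (pd i f) := contDiff_pd hf
  have hT : ContDiff ℝ ∞ (fun x => Real.arctan (pd i f x)) := hP.arctan
  have hφ2 : ContDiff ℝ ∞ (fun x => φ x ^ 2) := hφ.pow 2
  have hc2 : HasCompactSupport (fun x => φ x ^ 2) := by
    simp only [sq]; exact hc.mul_right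
  have hweak := integral_flux_eq_zero (contDiff_pd (i := i) (contDiff_kropinaFlux hf hgrad 0))
    (contDiff_pd (i := i) (contDiff_kropinaFlux hf hgrad 1)) (hφ2.mul hT) hc2.mul_right
    (div_pd_kropinaFlux hf hgrad hdiv i)
  rw [← hweak]
  congr 1
  ext x
  have h1 := hφ2.differentiable (by simp) x
  have h2 := hT.differentiable (by simp) x
  have h3 := hφ.differentiable (by simp) x
  have h4 := hP.differentiable (by simp) x
  have hTpd : ∀ j, pd j (fun x => Real.arctan (pd i f x)) x =
      1 / (1 + pd i f x ^ 2) * pd j (pd i f) x := fun j =>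
    pd_comp h4 (Real.hasDerivAt_arctan _)
  rw [pd_mul h1 h2, pd_mul h1 h2, pd_sq h3, pd_sq h3, hTpd, hTpd,
    pd_kropinaFlux hf hgrad, pd_kropinaFlux hf hgrad, pd_comm (i := i) (j := 0) hf,
    pd_comm (i := i) (j := 1) hf]
  unfold energyDensity linForm
  ring

/-- The localized stability inequality. -/
lemma exists_stability_bound (hf : ContDiff ℝ ∞ f)
    (hgrad : ∀ x, 2 ≤ pd 0 f x ^ 2 + pd 1 f x ^ 2)
    (hdiv : ∀ x, pd 0 (kropinaFlux f 0) x + pd 1 (kropinaFlux f 1) x = 0) (i : Fin 2) :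
    ∃ C : ℝ, 0 ≤ C ∧ ∀ R : ℝ, 0 < R → ∀ t : ℝ, 0 < t → ∀ θ : Plane → ℝ, Continuous θ →
      HasCompactSupport θ → (∀ x, 0 ≤ θ x) →
      (∀ x, R ^ 2 ≤ x 0 ^ 2 + x 1 ^ 2 + f x ^ 2 → x 0 ^ 2 + x 1 ^ 2 + f x ^ 2 ≤ 2 * R ^ 2 →
        graphCutoff f (R ^ 2) x ^ 2 ≤ θ x) →
      ∫ x, graphCutoff f (R ^ 2) x ^ 2 * energyDensity f i x ≤
        t * (∫ x, θ x * energyDensity f i x) + t⁻¹ * C := by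
  obtain ⟨K, hK0, hK⟩ := exists_deriv_cutoff_bound
  obtain ⟨A, hA0, hA⟩ := exists_integral_areaDensity_le hf hgrad hdiv
  refine ⟨384 * K ^ 2 * A, by positivity, fun R hR t ht θ hθc hθs hθ0 hθ => ?_⟩
  set φ := graphCutoff f (R ^ 2) with hφdef
  have hφ : ContDiff ℝ ∞ φ := contDiff_graphCutoff hf
  have hφc : HasCompactSupport φ := hasCompactSupport_graphCutoff (by positivity)
  have hS := continuous_energyDensity hf hgrad i
  have hS0 := energyDensity_nonneg hgrad i
  set B : Plane → ℝ := fun x => 2 * φ x * Real.arctan (pd i f x) *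
    linForm (pd 0 f x) (pd 1 f x) (pd 0 (pd i f) x) (pd 1 (pd i f) x)
      (pd 0 φ x) (pd 1 φ x) with hB
  have hzero : ∫ x, (φ x ^ 2 * energyDensity f i x + B x) = 0 :=
    integral_energyDensity_add_eq_zero hf hgrad hdiv i hφ hφc
  have hBcont : Continuous B := by
    have h := fun j => (contDiff_pd (i := j) (contDiff_pd (i := i) hf)).continuous
    have h1 := (contDiff_pd (i := i) hf).continuous
    have h2 := fun j => (contDiff_pd (i := j) hφ).continuous
    exact ((continuous_const.mul hφ.continuous).mul (Real.continuous_arctan.comp h1)).mul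
      (continuous_linForm_comp hf hgrad (h 0) (h 1) (h2 0) (h2 1))
  have hBi : Integrable B := hBcont.integrable_of_hasCompactSupport
    ((hφc.mul_left (f := fun _ => (2 : ℝ))).mul_right.mul_right)
  have hφ2c : HasCompactSupport (fun x => φ x ^ 2) := by
    simp only [sq]; exact hφc.mul_right
  have hφSi : Integrable (fun x => φ x ^ 2 * energyDensity f i x) :=
    ((hφ.continuous.pow 2).mul hS).integrable_of_hasCompactSupport hφ2c.mul_right
  have hθSi : Integrable (fun x => θ x * energyDensity f i x) :=
    (hθc.mul hS).integrable_of_hasCompactSupport hθs.mul_right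
  have hGi : Integrable (areaDensity f R) :=
    (continuous_areaDensity hf hgrad R).integrable_of_hasCompactSupport
      (hasCompactSupport_areaDensity hR)
  rw [integral_add hφSi hBi] at hzero
  have hpt : ∀ x, -B x ≤ t * (θ x * energyDensity f i x) +
      t⁻¹ * (384 * K ^ 2 / R ^ 2 * areaDensity f R x) := by
    intro x
    have hG0 := areaDensity_nonneg hgrad R x
    have hθS : 0 ≤ θ x * energyDensity f i x := mul_nonneg (hθ0 x) (hS0 x)
    set ρ := x 0 ^ 2 + x 1 ^ 2 + f x ^ 2 with hρ
    set η := deriv cutoff (ρ / R ^ 2) with hη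
    have hpd : ∀ j, pd j φ x = 2 / R ^ 2 * η * x j + 2 / R ^ 2 * η * f x * pd j f x := by
      intro j
      rw [hφdef, pd_graphCutoff hf]
      ring
    by_cases hη0 : η = 0
    · have : B x = 0 := by
        simp only [hB, hpd, hη0]
        simp [linForm]
      rw [this, neg_zero]
      positivity
    have hρ1 : R ^ 2 ≤ ρ := by
      by_contra! h
      exact hη0 (deriv_cutoff_of_le ((div_le_one (by positivity)).2 h.le))
    have hρ2 : ρ ≤ 2 * R ^ 2 := by
      by_contra! h
      exact hη0 (deriv_cutoff_of_ge ((le_div_iff₀ (by positivity)).2 h.le))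
    have hyoung := linForm_young (hgrad x) (pd 0 (pd i f) x) (pd 1 (pd i f) x) (pd 0 φ x)
      (pd 1 φ x) ht (by positivity : 0 < 1 + pd i f x ^ 2) (φ x) (Real.arctan (pd i f x))
    refine hyoung.trans ?_
    have hm : 1 + pd i f x ^ 2 ≤ 1 + (pd 0 f x ^ 2 + pd 1 f x ^ 2) := by
      fin_cases i <;> simp [sq_nonneg]
    have hW := sqrt_le_areaDensity hgrad hR hρ2
    have hw0 := linForm_nonneg (hgrad x) (pd 0 φ x) (pd 1 φ x)
    have hk : Real.arctan (pd i f x) ^ 2 ≤ 4 := by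
      have := abs_le.1 (abs_arctan_le_two (pd i f x))
      nlinarith
    have hsize : (2 / R ^ 2 * η * x 0) ^ 2 + (2 / R ^ 2 * η * x 1) ^ 2 +
        (2 / R ^ 2 * η * f x) ^ 2 ≤ 8 * K ^ 2 / R ^ 2 := by
      have e : (2 / R ^ 2 * η * x 0) ^ 2 + (2 / R ^ 2 * η * x 1) ^ 2 +
        (2 / R ^ 2 * η * f x) ^ 2 = 4 / R ^ 4 * η ^ 2 * ρ := by
        rw [hρ]; field_simp; ring
      have hη2 : η ^ 2 ≤ K ^ 2 := sq_le_sq' (neg_le_of_abs_le (hK _)) (le_of_abs_le (hK _))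
      rw [e]
      calc 4 / R ^ 4 * η ^ 2 * ρ ≤ 4 / R ^ 4 * K ^ 2 * (2 * R ^ 2) := by gcongr
        _ = 8 * K ^ 2 / R ^ 2 := by field_simp; ring
    have hform : (1 + pd i f x ^ 2) * linForm (pd 0 f x) (pd 1 f x) (pd 0 φ x) (pd 1 φ x)
        (pd 0 φ x) (pd 1 φ x) ≤ 12 * areaDensity f R x * (8 * K ^ 2 / R ^ 2) := by
      refine (mul_le_mul_of_nonneg_right hm hw0).trans ?_
      rw [hpd 0, hpd 1]
      refine (linForm_le (hgrad x) _ _ _).trans ?_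
      gcongr
    have hfin : Real.arctan (pd i f x) ^ 2 * ((1 + pd i f x ^ 2) *
        linForm (pd 0 f x) (pd 1 f x) (pd 0 φ x) (pd 1 φ x) (pd 0 φ x) (pd 1 φ x)) ≤
        384 * K ^ 2 / R ^ 2 * areaDensity f R x := by
      calc _ ≤ 4 * (12 * areaDensity f R x * (8 * K ^ 2 / R ^ 2)) := by gcongr
        _ = _ := by ring
    have hθx : φ x ^ 2 * energyDensity f i x ≤ θ x * energyDensity f i x :=
      mul_le_mul_of_nonneg_right (hθ x hρ1 hρ2) (hS0 x)
    unfold energyDensity at hθx ⊢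
    gcongr
  have hint : ∫ x, -B x ≤ ∫ x, (t * (θ x * energyDensity f i x) +
      t⁻¹ * (384 * K ^ 2 / R ^ 2 * areaDensity f R x)) :=
    integral_mono hBi.neg ((hθSi.const_mul t).add ((hGi.const_mul _).const_mul _)) hpt
  rw [integral_neg, integral_add (hθSi.const_mul t) ((hGi.const_mul _).const_mul _),
    integral_const_mul, integral_const_mul, integral_const_mul] at hint
  have hArea : t⁻¹ * (384 * K ^ 2 / R ^ 2 * ∫ x, areaDensity f R x) ≤
      t⁻¹ * (384 * K ^ 2 * A) := by
    have h1 := hA R hR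
    refine mul_le_mul_of_nonneg_left ?_ (by positivity)
    calc 384 * K ^ 2 / R ^ 2 * ∫ x, areaDensity f R x
        ≤ 384 * K ^ 2 / R ^ 2 * (A * R ^ 2) := by gcongr
      _ = 384 * K ^ 2 * A := by field_simp
  linarith

lemma eq_zero_of_hole_filling {a : ℕ → ℝ} {C : ℝ} (h0 : ∀ n, 0 ≤ a n) (hmono : Monotone a)
    (hself : ∀ n, ∀ t : ℝ, 0 < t → a n ≤ t * a n + t⁻¹ * C)
    (hstep : ∀ n, ∀ t : ℝ, 0 < t → a (n + 1) ≤ t * (a (n + 2) - a n) + t⁻¹ * C) (n : ℕ) :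
    a n = 0 := by
  have hb : BddAbove (Set.range a) := by
    refine ⟨4 * C, ?_⟩
    rintro _ ⟨m, rfl⟩
    have := hself m (1 / 2) (by norm_num)
    norm_num at this
    linarith
  have hlim := tendsto_atTop_ciSup hmono hb
  set L := ⨆ n, a n
  have hL : ∀ t : ℝ, 0 < t → L ≤ t⁻¹ * C := by
    intro t ht
    have h1 : Tendsto (fun n => a (n + 1)) atTop (𝓝 L) := hlim.comp (tendsto_add_atTop_nat 1)
    have h2 : Tendsto (fun n => a (n + 2)) atTop (𝓝 L) := hlim.comp (tendsto_add_atTop_nat 2)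
    have h3 := ((h2.sub hlim).const_mul t).add_const (t⁻¹ * C)
    simpa using le_of_tendsto_of_tendsto' h1 h3 fun n => hstep n t ht
  have hz : Tendsto (fun t : ℝ => t⁻¹ * C) atTop (𝓝 0) := by
    simpa using tendsto_inv_atTop_zero.mul_const C
  have hL0 : L ≤ 0 := ge_of_tendsto hz ((eventually_gt_atTop 0).mono fun t ht => hL t ht)
  exact le_antisymm ((le_ciSup hb n).trans hL0) (h0 n)

lemma energyDensity_eq_zero (hf : ContDiff ℝ ∞ f)
    (hgrad : ∀ x, 2 ≤ pd 0 f x ^ 2 + pd 1 f x ^ 2)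
    (hdiv : ∀ x, pd 0 (kropinaFlux f 0) x + pd 1 (kropinaFlux f 1) x = 0) (i : Fin 2)
    (x : Plane) : energyDensity f i x = 0 := by
  obtain ⟨C, hC0, hC⟩ := exists_stability_bound hf hgrad hdiv i
  have hS := continuous_energyDensity hf hgrad i
  have hS0 := energyDensity_nonneg hgrad i
  set ψ : ℕ → Plane → ℝ := fun n x => graphCutoff f (((2 : ℝ) ^ n) ^ 2) x ^ 2 with hψ
  have hψ0 : ∀ n x, 0 ≤ ψ n x := fun n x => sq_nonneg _
  have hψ1 : ∀ n x, ψ n x ≤ 1 := fun n x =>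
    pow_le_one₀ (graphCutoff_nonneg x) (graphCutoff_le_one x)
  have hψcont : ∀ n, Continuous (ψ n) := fun n => (contDiff_graphCutoff hf).continuous.pow 2
  have hψc : ∀ n, HasCompactSupport (ψ n) := fun n => by
    simp only [hψ, sq (graphCutoff _ _ _)]
    exact (hasCompactSupport_graphCutoff (by positivity)).mul_right
  have hpow : ∀ n : ℕ, ((2 : ℝ) ^ (n + 1)) ^ 2 = 4 * ((2 : ℝ) ^ n) ^ 2 := fun n => by ring
  have hψsucc_one : ∀ n x, x 0 ^ 2 + x 1 ^ 2 + f x ^ 2 ≤ 2 * ((2 : ℝ) ^ n) ^ 2 →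
      ψ (n + 1) x = 1 := by
    intro n x hx
    have : 0 < ((2 : ℝ) ^ n) ^ 2 := by positivity
    simp only [hψ]
    rw [graphCutoff_eq_one (by positivity) (by rw [hpow]; linarith), one_pow]
  have hψzero : ∀ n x, 2 * ((2 : ℝ) ^ n) ^ 2 ≤ x 0 ^ 2 + x 1 ^ 2 + f x ^ 2 → ψ n x = 0 := by
    intro n x hx
    simp only [hψ]
    rw [graphCutoff_eq_zero (by positivity) hx]
    simp
  have hψmono : ∀ n x, ψ n x ≤ ψ (n + 1) x := by
    intro n x
    rcases le_total (x 0 ^ 2 + x 1 ^ 2 + f x ^ 2) (2 * ((2 : ℝ) ^ n) ^ 2) with h | h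
    · rw [hψsucc_one n x h]; exact hψ1 n x
    · rw [hψzero n x h]; exact hψ0 _ x
  have hi : ∀ n, Integrable (fun x => ψ n x * energyDensity f i x) := fun n =>
    ((hψcont n).mul hS).integrable_of_hasCompactSupport (hψc n).mul_right
  set a : ℕ → ℝ := fun n => ∫ x, ψ n x * energyDensity f i x with ha
  have ha0 : ∀ n, a n = 0 := by
    refine eq_zero_of_hole_filling (C := C)
      (fun n => integral_nonneg fun x => mul_nonneg (hψ0 n x) (hS0 x))
      (monotone_nat_of_le_succ fun n => integral_mono (hi n) (hi (n + 1)) fun x =>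
        mul_le_mul_of_nonneg_right (hψmono n x) (hS0 x)) ?_ ?_
    · intro n t ht
      exact hC _ (by positivity) t ht (ψ n) (hψcont n) (hψc n) (hψ0 n) fun x _ _ => le_rfl
    · intro n t ht
      have h := hC (2 ^ (n + 1)) (by positivity) t ht (fun x => ψ (n + 2) x - ψ n x)
        ((hψcont _).sub (hψcont _)) ((hψc _).sub (hψc _))
        (fun x => sub_nonneg.2 ((hψmono n x).trans (hψmono (n + 1) x))) (by
          intro x h1 h2
          rw [hψsucc_one (n + 1) x h2, hψzero n x (by
            rw [hpow] at h1
            have : 0 < ((2 : ℝ) ^ n) ^ 2 := by positivity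
            linarith), sub_zero]
          exact hψ1 (n + 1) x)
      simp_rw [sub_mul] at h
      rw [integral_sub (hi _) (hi _)] at h
      exact h
  obtain ⟨n, hn⟩ := pow_unbounded_of_one_lt (x 0 ^ 2 + x 1 ^ 2 + f x ^ 2) (one_lt_two (α := ℝ))
  have hn1 : ψ (n + 1) x = 1 := by
    apply hψsucc_one
    have : (1 : ℝ) ≤ 2 ^ n := one_le_pow₀ one_le_two
    nlinarith
  have hae := (integral_eq_zero_iff_of_nonneg
    (fun x => mul_nonneg (hψ0 (n + 1) x) (hS0 x)) (hi (n + 1))).1 (ha0 (n + 1))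
  have heq := (Continuous.ae_eq_iff_eq (volume : Measure Plane) ((hψcont (n + 1)).mul hS)
    continuous_const).1 hae
  have hx := congrFun heq x
  simpa [hn1] using! hx

end Stability

/-- Bernstein-type theorem (Theorem 1.2): a smooth entire solution `f` of the Kropina
minimal-graph PDE with `f₁² + f₂² ≥ 2` everywhere (i.e. `W² ≥ 3`) is affine. Here
`W² = 1 + f₁² + f₂²` and `δ_{εη}` is the Kronecker delta. -/
theorem stmt_4 (f : EuclideanSpace ℝ (Fin 2) → ℝ) (hf : ContDiff ℝ (⊤ : ℕ∞) f)
    (hgrad : ∀ x : EuclideanSpace ℝ (Fin 2), 2 ≤ pd 0 f x ^ 2 + pd 1 f x ^ 2)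
    (hpde : ∀ x : EuclideanSpace ℝ (Fin 2),
      (∑ ε : Fin 2, ∑ η : Fin 2,
        (((1 + pd 0 f x ^ 2 + pd 1 f x ^ 2) - 1) * ((1 + pd 0 f x ^ 2 + pd 1 f x ^ 2) - 3) *
            ((if ε = η then (1 : ℝ) else 0) -
              pd ε f x * pd η f x / (1 + pd 0 f x ^ 2 + pd 1 f x ^ 2)) +
          2 * ((1 + pd 0 f x ^ 2 + pd 1 f x ^ 2) + 3) *
            (pd ε f x * pd η f x / (1 + pd 0 f x ^ 2 + pd 1 f x ^ 2))) *
          pd η (pd ε f) x) = 0) :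
    ∃ a₁ a₂ c : ℝ, ∀ x : EuclideanSpace ℝ (Fin 2), f x = a₁ * x 0 + a₂ * x 1 + c := by
  have hdiv : ∀ x, pd 0 (kropinaFlux f 0) x + pd 1 (kropinaFlux f 1) x = 0 := by
    intro x
    have h := hpde x
    have hq := hgrad x
    rw [pd_kropinaFlux hf hgrad, pd_kropinaFlux hf hgrad]
    simp only [Fin.sum_univ_two, if_true, one_ne_zero, zero_ne_one, if_false] at h
    rw [pd_comm (i := 1) (j := 0) hf] at h ⊢
    set p := pd 0 f x
    set r := pd 1 f x
    set u := pd 0 (pd 0 f) x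
    set v := pd 0 (pd 1 f) x
    set w := pd 1 (pd 1 f) x
    have hw : 0 < √(1 + (p ^ 2 + r ^ 2)) := Real.sqrt_pos.2 (by linarith)
    have hw2 : √(1 + (p ^ 2 + r ^ 2)) ^ 2 = 1 + (p ^ 2 + r ^ 2) := Real.sq_sqrt (by linarith)
    have hq0 : 0 < p ^ 2 + r ^ 2 := by linarith
    have h1 : 0 < 1 + p ^ 2 + r ^ 2 := by linarith
    rw [← mul_zero (√(1 + (p ^ 2 + r ^ 2)) / (p ^ 2 + r ^ 2) ^ 3), ← h]
    unfold conductivity conductivityDeriv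
    rw [add_assoc] at h1 ⊢
    generalize √(1 + (p ^ 2 + r ^ 2)) = z at *
    field_simp
    rw [hw2]
    ring
  have hH : ∀ i x, pd 0 f x * pd 0 (pd i f) x + pd 1 f x * pd 1 (pd i f) x = 0 := by
    intro i x
    have h := energyDensity_eq_zero hf hgrad hdiv i x
    unfold energyDensity at h
    rcases div_eq_zero_iff.1 h with h | h
    · exact eq_zero_of_linForm_eq_zero (hgrad x) h
    · exact absurd h (by positivity)
  exact ⟨pd 0 f 0, pd 1 f 0, f 0,
    affine_of_hessian_grad_eq_zero hf hH (by linarith [hgrad 0])⟩
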